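/- Let R and S be finite trees (finite nonempty connected acyclic simple graphs). If there exists a graph homomorphism φ : R → S such that every vertex of R of degree 2 is sent to a vertex of S of degree at least 2 and every vertex of R of degree at least 3 is sent to a vertex of S of degree at least 3, then there exists an injective group homomorphism from C(R) to C(S). -/

import Mathlib

/-- The defining relations of the right-angled Coxeter group of a simple graph:
squares of the generators, and squares of products of generators corresponding to
adjacent vertices. -/
def racgRels {V : Type*} (G : SimpleGraph V) : Set (FreeGroup V) :=
  {r | (∃ v : V, r = FreeGroup.of v * FreeGroup.of v) ∨
    ∃ u v : V, G.Adj u v ∧ r = (FreeGroup.of u * FreeGroup.of v) ^ 2}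

/-- The right-angled Coxeter group of a simple graph. -/
abbrev RACG {V : Type*} (G : SimpleGraph V) : Type _ := PresentedGroup (racgRels G)

/-- The canonical generator of the right-angled Coxeter group corresponding to a vertex. -/
def racgGen {V : Type*} (G : SimpleGraph V) (v : V) : RACG G := PresentedGroup.of v

/-- A reflection of a right-angled Coxeter group: a conjugate of a canonical generator. -/
def IsReflection {V : Type*} (G : SimpleGraph V) (x : RACG G) : Prop :=
  ∃ (g : RACG G) (v : V), x = g * racgGen G v * g⁻¹

/-- Word length on a right-angled Coxeter group with respect to the canonical generators
(the generators are involutions, so words in the generators suffice). -/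
noncomputable def racgLen {V : Type*} (G : SimpleGraph V) (x : RACG G) : ℕ :=
  sInf {n | ∃ l : List V, l.length = n ∧ (l.map (racgGen G)).prod = x}

section PingPong

variable {V M : Type*} [AddCommGroup M]

/-- The reflection in a vector of norm one with respect to an integral bilinear form. -/
noncomputable def unitReflection (B : LinearMap.BilinForm ℤ M) (a : M) (ha : B a a = 1) :
    M ≃ₗ[ℤ] M :=
  Module.reflection (x := a) (f := (2 : ℤ) • B.flip a) (by simp [ha])

theorem unitReflection_apply (B : LinearMap.BilinForm ℤ M) (a : M) (ha : B a a = 1) (m : M) :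
    unitReflection B a ha m = m - (2 * B m a) • a := by
  simp [unitReflection, Module.reflection_apply]

theorem unitReflection_mul_self (B : LinearMap.BilinForm ℤ M) (a : M) (ha : B a a = 1) :
    unitReflection B a ha * unitReflection B a ha = 1 := by
  ext m
  simp [unitReflection_apply, ha, two_mul, add_smul]
  abel

theorem unitReflection_commute (B : LinearMap.BilinForm ℤ M) (a b : M) (ha : B a a = 1)
    (hb : B b b = 1) (hab : B a b = 0) (hba : B b a = 0) :
    unitReflection B a ha * unitReflection B b hb =
      unitReflection B b hb * unitReflection B a ha := by
  ext m
  simp [unitReflection_apply, hab, hba]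
  abel

theorem racgGen_mul_self (G : SimpleGraph V) (v : V) : racgGen G v * racgGen G v = 1 :=
  (PresentedGroup.one_of_mem (rels := racgRels G) (Or.inl ⟨v, rfl⟩) :)

theorem racgGen_inv (G : SimpleGraph V) (v : V) : (racgGen G v)⁻¹ = racgGen G v :=
  inv_eq_of_mul_eq_one_left (racgGen_mul_self G v)

theorem racgGen_comm (G : SimpleGraph V) {u v : V} (h : G.Adj u v) :
    racgGen G u * racgGen G v = racgGen G v * racgGen G u := by
  have h1 : (racgGen G u * racgGen G v) ^ 2 = 1 :=
    (PresentedGroup.one_of_mem (rels := racgRels G) (Or.inr ⟨u, v, h, rfl⟩) :)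
  rw [sq] at h1
  rw [eq_inv_of_mul_eq_one_left h1, mul_inv_rev, racgGen_inv, racgGen_inv]

theorem exists_list_racgGen_prod (G : SimpleGraph V) (g : RACG G) :
    ∃ l : List V, (l.map (racgGen G)).prod = g := by
  have hg : g ∈ Subgroup.closure (Set.range (PresentedGroup.of (rels := racgRels G))) := by
    rw [PresentedGroup.closure_range_of]; trivial
  induction hg using Subgroup.closure_induction with
  | mem x hx => obtain ⟨v, rfl⟩ := hx; exact ⟨[v], by simp [racgGen]⟩
  | one => exact ⟨[], rfl⟩
  | mul x y _ _ hx hy =>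
    obtain ⟨l, rfl⟩ := hx
    obtain ⟨l', rfl⟩ := hy
    exact ⟨l ++ l', by simp⟩
  | inv x _ hx =>
    obtain ⟨l, rfl⟩ := hx
    refine ⟨l.reverse, ?_⟩
    rw [List.prod_inv_reverse, List.map_map, List.map_reverse]
    congr 3
    exact funext fun v => (racgGen_inv G v).symm

/-- Unit vectors that pair like the simple roots of the right-angled Coxeter group of a graph:
adjacent vertices give orthogonal vectors, other pairs of vertices give vectors with pairing
at most `-1`, and all the vectors lie in a common open half space. -/
structure RootSystem (G : SimpleGraph V) (B : LinearMap.BilinForm ℤ M) (x : M →ₗ[ℤ] ℤ)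
    (a : V → M) : Prop where
  self : ∀ v, B (a v) (a v) = 1
  adj : ∀ u v, G.Adj u v → B (a u) (a v) = 0
  not_adj : ∀ u v, u ≠ v → ¬ G.Adj u v → B (a u) (a v) ≤ -1
  pos : ∀ v, 0 < x (a v)

namespace RootSystem

variable {G : SimpleGraph V} {B : LinearMap.BilinForm ℤ M} {x : M →ₗ[ℤ] ℤ} {a : V → M}

/-- The representation of the right-angled Coxeter group by the reflections of a root system. -/
noncomputable def rep (h : RootSystem G B x a) : RACG G →* (M ≃ₗ[ℤ] M) :=
  PresentedGroup.toGroup (f := fun v => unitReflection B (a v) (h.self v)) (by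
    rintro r (⟨v, rfl⟩ | ⟨u, v, huv, rfl⟩)
    · simp [unitReflection_mul_self]
    · rw [map_pow, map_mul, FreeGroup.lift_apply_of, FreeGroup.lift_apply_of, sq]
      nth_rw 1 [unitReflection_commute B _ _ _ _ (h.adj _ _ huv) (h.adj _ _ huv.symm)]
      rw [mul_assoc, ← mul_assoc (unitReflection B (a u) _), unitReflection_mul_self, one_mul,
        unitReflection_mul_self])

theorem rep_gen (h : RootSystem G B x a) (v : V) :
    h.rep (racgGen G v) = unitReflection B (a v) (h.self v) :=
  PresentedGroup.toGroup.of _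

theorem rep_list_cons (h : RootSystem G B x a) (v u : V) (l : List V) :
    x ((h.rep (((v :: l).map (racgGen G)).prod))⁻¹ (a u)) =
      x ((h.rep ((l.map (racgGen G)).prod))⁻¹ (a u)) -
        2 * B (a u) (a v) * x ((h.rep ((l.map (racgGen G)).prod))⁻¹ (a v)) := by
  rw [List.map_cons, List.prod_cons, map_mul, mul_inv_rev, LinearEquiv.mul_apply,
    ← map_inv, ← map_inv, racgGen_inv, rep_gen, unitReflection_apply]
  simp

theorem rep_list_of_minimal (h : RootSystem G B x a) (l : List V)
    (hl : ∀ l' : List V, (l'.map (racgGen G)).prod = (l.map (racgGen G)).prod →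
      l.length ≤ l'.length) :
    (∀ u, x ((h.rep ((l.map (racgGen G)).prod))⁻¹ (a u)) ≠ 0) ∧
    (∀ u, x ((h.rep ((l.map (racgGen G)).prod))⁻¹ (a u)) < 0 → ∃ l' : List V,
      l'.length + 1 = l.length ∧ ((u :: l').map (racgGen G)).prod = (l.map (racgGen G)).prod) ∧
    (∀ u v, u ≠ v → ¬ G.Adj u v → 0 < x ((h.rep ((l.map (racgGen G)).prod))⁻¹ (a u)) +
      x ((h.rep ((l.map (racgGen G)).prod))⁻¹ (a v))) ∧
    (∀ v l', l = v :: l' → 0 < x ((h.rep ((l'.map (racgGen G)).prod))⁻¹ (a v))) := by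
  induction l with
  | nil =>
    have hp := h.pos
    refine ⟨fun u => ?_, fun u hu => ?_, fun u v _ _ => ?_, by simp⟩
    · simpa using (hp u).ne'
    · simp at hu; linarith [hp u]
    · simpa using add_pos (hp u) (hp v)
  | cons v l ih =>
    obtain ⟨h0, hneg, hsum, -⟩ := ih (fun l' hl' => by
      have := hl (v :: l') (by simp [hl'])
      simpa using this)
    have hv : 0 < x ((h.rep ((l.map (racgGen G)).prod))⁻¹ (a v)) := by
      rcases lt_or_gt_of_ne (h0 v) with hlt | hgt
      · obtain ⟨l', hlen, hprod⟩ := hneg v hlt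
        have := hl l' (by
          rw [List.map_cons, List.prod_cons, ← hprod, List.map_cons, List.prod_cons, ← mul_assoc,
            racgGen_mul_self, one_mul])
        simp at this
        omega
      · exact hgt
    simp only [rep_list_cons]
    have hB : ∀ u, u ≠ v → B (a u) (a v) ≤ 0 := fun u hu => by
      by_cases huv : G.Adj u v
      · exact (h.adj u v huv).le
      · linarith [h.not_adj u v hu huv]
    set F : V → ℤ := fun u => x ((h.rep ((l.map (racgGen G)).prod))⁻¹ (a u)) with hF
    change (∀ u, F u - 2 * B (a u) (a v) * F v ≠ 0) ∧
      (∀ u, F u - 2 * B (a u) (a v) * F v < 0 → _) ∧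
      (∀ u w, u ≠ w → ¬ G.Adj u w → 0 < F u - 2 * B (a u) (a v) * F v +
        (F w - 2 * B (a w) (a v) * F v)) ∧ _
    change 0 < F v at hv
    change ∀ u, F u ≠ 0 at h0
    change ∀ u v, u ≠ v → ¬ G.Adj u v → 0 < F u + F v at hsum
    have hpos : ∀ u, u ≠ v → ¬ G.Adj u v →
        0 < F u - 2 * B (a u) (a v) * F v ∧ 0 < F u - 2 * B (a u) (a v) * F v - F v :=
      fun u hu huv => by
        have h1 := hsum u v hu huv
        have h2 := h.not_adj u v hu huv
        constructor <;> nlinarith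
    refine ⟨fun u => ?_, fun u hu => ?_, fun u w huw hadj => ?_, ?_⟩
    · by_cases huv : u = v
      · subst huv; rw [h.self]; linarith
      by_cases hadj : G.Adj u v
      · rw [h.adj _ _ hadj]; simpa using h0 u
      · exact (hpos u huv hadj).1.ne'
    · by_cases huv : u = v
      · subst huv; exact ⟨l, rfl, rfl⟩
      by_cases hadj : G.Adj u v
      · rw [h.adj _ _ hadj] at hu
        obtain ⟨l', hlen, hprod⟩ := hneg u (by
          rw [mul_zero, zero_mul, sub_zero] at hu; exact hu)
        refine ⟨v :: l', by simp [hlen], ?_⟩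
        simp only [List.map_cons, List.prod_cons] at hprod ⊢
        rw [← hprod, ← mul_assoc, ← mul_assoc, racgGen_comm G hadj]
      · exact absurd hu (hpos u huv hadj).1.le.not_gt
    · by_cases huv : u = v
      · subst huv
        rw [h.self]
        linarith [(hpos w huw.symm fun hw => hadj hw.symm).2]
      by_cases hwv : w = v
      · subst hwv
        rw [h.self]
        linarith [(hpos u huw hadj).2]
      have := hsum u w huw hadj
      nlinarith [hB u huv, hB w hwv, mul_nonneg (neg_nonneg.2 (hB u huv)) hv.le,
        mul_nonneg (neg_nonneg.2 (hB w hwv)) hv.le]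
    · rintro v' l' heq
      obtain ⟨rfl, rfl⟩ := List.cons.inj heq
      exact hv

theorem rep_injective (h : RootSystem G B x a) : Function.Injective h.rep := by
  rw [injective_iff_map_eq_one]
  intro g hg
  have hex : ∃ n, ∃ l : List V, l.length = n ∧ (l.map (racgGen G)).prod = g := by
    obtain ⟨l, hl⟩ := exists_list_racgGen_prod G g
    exact ⟨_, l, rfl, hl⟩
  classical
  obtain ⟨l, hlen, hl⟩ := Nat.find_spec hex
  have hmin := (h.rep_list_of_minimal l fun l' hl' => by
    rw [hlen]; exact Nat.find_min' hex ⟨l', rfl, hl'.trans hl⟩).2.2.2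
  match l, hl, hmin with
  | [], hl, _ => exact hl.symm
  | v :: l, hl, hmin =>
    exfalso
    have h1 := h.rep_list_cons v v l
    have h2 := hmin v l rfl
    have h3 := h.pos v
    rw [hl, hg, h.self, inv_one] at h1
    change x (a v) = _ at h1
    linarith

theorem exists_injective_hom {W : Type*} {H : SimpleGraph W} {c : W → M}
    (h : RootSystem G B x a) (k : RootSystem H B x c)
    (hc : ∀ w, unitReflection B (c w) (k.self w) ∈ h.rep.range) :
    ∃ f : RACG H →* RACG G, Function.Injective f := by
  have hr : ∀ g, k.rep g ∈ h.rep.range := fun g => by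
    obtain ⟨l, rfl⟩ := exists_list_racgGen_prod H g
    rw [map_list_prod]
    refine Subgroup.list_prod_mem _ fun y hy => ?_
    simp only [List.map_map, List.mem_map, Function.comp] at hy
    obtain ⟨w, -, rfl⟩ := hy
    rw [rep_gen]
    exact hc w
  refine ⟨(MonoidHom.ofInjective h.rep_injective).symm.toMonoidHom.comp
    (k.rep.codRestrict _ hr), ?_⟩
  refine (MulEquiv.injective (MonoidHom.ofInjective h.rep_injective).symm).comp
    fun g g' hgg => k.rep_injective ?_
  exact congrArg Subtype.val hgg

end RootSystem

end PingPong

namespace SimpleGraph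

variable {V : Type*} {G : SimpleGraph V} {x z y : V}

/-- `G.Side x z y` says that some path from `x` to `y` starts with the edge from `x` to `z`. In a
tree these `y` are the vertices on the side of `z` of that edge. -/
def Side (G : SimpleGraph V) (x z y : V) : Prop :=
  ∃ (h : G.Adj x z) (p : G.Walk z y), (Walk.cons h p).IsPath

theorem Side.adj (h : G.Side x z y) : G.Adj x z := h.1

theorem Adj.side (h : G.Adj x z) : G.Side x z z := ⟨h, .nil, by simp [h.ne]⟩

theorem Side.ne (h : G.Side x z y) : y ≠ x := by
  obtain ⟨h, p, hp⟩ := h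
  rintro rfl
  exact ((Walk.cons_isPath_iff _ _).1 hp).2 p.end_mem_support

theorem Side.eq_or_exists (h : G.Side x z y) : y = z ∨ ∃ u, u ≠ x ∧ G.Side z u y := by
  obtain ⟨h, p, hp⟩ := h
  cases p with
  | nil => exact .inl rfl
  | @cons _ u _ hu q =>
    rw [Walk.cons_isPath_iff] at hp
    refine .inr ⟨u, ?_, hu, q, hp.1⟩
    rintro rfl
    exact hp.2 (by simp)

theorem Side.step {y' : V} (h : G.Side x z y) (hy : G.Adj y y') (hx : y' ≠ x) :
    G.Side x z y' := by
  classical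
  obtain ⟨h, p, hp⟩ := h
  rw [Walk.cons_isPath_iff] at hp
  by_cases hmem : y' ∈ p.support
  · refine ⟨h, p.takeUntil y' hmem, ?_⟩
    rw [Walk.cons_isPath_iff]
    exact ⟨hp.1.takeUntil hmem, fun hx' => hp.2 (p.support_takeUntil_subset_support hmem hx')⟩
  · refine ⟨h, p.concat hy, ?_⟩
    rw [Walk.cons_isPath_iff]
    refine ⟨hp.1.concat hmem hy, ?_⟩
    rw [Walk.support_concat]
    simp [hp.2, hx.symm]

namespace IsAcyclic

theorem side_symm (hG : G.IsAcyclic) {x' : V} (h : G.Side x z y) (hx : G.Adj x x')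
    (hne : x' ≠ z) : G.Side x' x y := by
  classical
  obtain ⟨h, p, hp⟩ := h
  refine ⟨hx.symm, .cons h p, ?_⟩
  rw [Walk.cons_isPath_iff]
  refine ⟨hp, fun hmem => ?_⟩
  rw [Walk.cons_isPath_iff] at hp
  have hmem : x' ∈ p.support := by simpa [hx.ne'] using hmem
  have hq : (Walk.cons h (p.takeUntil x' hmem)).IsPath := by
    rw [Walk.cons_isPath_iff]
    exact ⟨hp.1.takeUntil hmem, fun hx' => hp.2 (p.support_takeUntil_subset_support hmem hx')⟩
  have hr : (Walk.cons hx .nil).IsPath := by simp [hx.ne]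
  have heq := congrArg (fun p : G.Path x x' => p.1.length)
    ((hG.subsingleton_path _ _).elim ⟨_, hq⟩ ⟨_, hr⟩)
  simp only [Walk.length_cons, Walk.length_nil, Nat.add_right_cancel_iff] at heq
  exact hne (Walk.eq_of_length_eq_zero heq).symm

theorem not_side_of_side (hG : G.IsAcyclic) (h : G.Side x z y) : ¬ G.Side z x y := by
  obtain ⟨h, p, hp⟩ := h
  rintro ⟨h', q, hq⟩
  rw [Walk.cons_isPath_iff] at hq
  have heq : q = Walk.cons h p :=
    congrArg Subtype.val ((hG.subsingleton_path _ _).elim (⟨_, hq.1⟩ : G.Path x y) ⟨_, hp⟩)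
  exact hq.2 (by simp [heq])

variable {z' : V}

theorem not_side_of_ne (hG : G.IsAcyclic) (h : G.Side x z y) (hx : G.Adj x z') (hne : z' ≠ z) :
    ¬ G.Side x z' y :=
  fun h' => hG.not_side_of_side h' (hG.side_symm h hx hne)

theorem ne_of_side (hG : G.IsAcyclic) (h : G.Side x z y) (hx : G.Adj x z') (hne : z' ≠ z) :
    y ≠ z' :=
  (hG.side_symm h hx hne).ne

theorem eq_of_side_of_adj (hG : G.IsAcyclic) (h : G.Side x z y) (hy : G.Adj x y) : y = z := by
  by_contra hne
  exact (hG.side_symm h hy hne).ne rfl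

theorem not_adj_of_side (hG : G.IsAcyclic) (h : G.Side x z y) (hx : G.Adj x z') (hne : z' ≠ z) :
    ¬ G.Adj z' y :=
  fun hy => h.ne (hG.eq_of_side_of_adj (hG.side_symm h hx hne) hy)

end IsAcyclic

theorem IsTree.side_or_side (hG : G.IsTree) (h : G.Adj x z) (y : V) :
    G.Side x z y ∨ G.Side z x y := by
  classical
  obtain ⟨p, hp⟩ := (hG.1.preconnected x y).exists_isPath
  cases p with
  | nil => exact .inr h.symm.side
  | @cons _ u _ hu q =>
    by_cases hz : z = u
    · subst hz; exact .inl ⟨hu, q, hp⟩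
    · exact .inr (hG.2.side_symm ⟨hu, q, hp⟩ h hz)

end SimpleGraph

section Form

variable {V : Type*} [Fintype V] (G : SimpleGraph V)

open Classical in
/-- The Tits form of a right-angled Coxeter group. -/
noncomputable def racgForm : LinearMap.BilinForm ℤ (V → ℤ) :=
  Matrix.toBilin' (Matrix.of fun u v => if u = v then 1 else if G.Adj u v then 0 else -1)

open Classical in
/-- The simple root of a vertex. -/
noncomputable def simpleRoot (v : V) : V → ℤ := Pi.single v 1

/-- The sum of the coordinates with respect to the simple roots. -/
noncomputable def rootHeight : (V → ℤ) →ₗ[ℤ] ℤ := ∑ v, LinearMap.proj v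

theorem rootHeight_simpleRoot (v : V) : rootHeight (simpleRoot v) = 1 := by
  simp [rootHeight, simpleRoot]

theorem racgForm_comm (a b : V → ℤ) : racgForm G a b = racgForm G b a := by
  classical
  simp only [racgForm, Matrix.toBilin'_apply, Matrix.of_apply]
  rw [Finset.sum_comm]
  refine Finset.sum_congr rfl fun u _ => Finset.sum_congr rfl fun v _ => ?_
  simp only [G.adj_comm u v, eq_comm (a := u) (b := v)]
  ring

variable {G}

theorem racgForm_self (v : V) : racgForm G (simpleRoot v) (simpleRoot v) = 1 := by
  simp [racgForm, simpleRoot]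

theorem racgForm_adj {u v : V} (h : G.Adj u v) :
    racgForm G (simpleRoot u) (simpleRoot v) = 0 := by
  simp [racgForm, simpleRoot, h, h.ne]

theorem racgForm_not_adj {u v : V} (hne : u ≠ v) (h : ¬ G.Adj u v) :
    racgForm G (simpleRoot u) (simpleRoot v) = -1 := by
  simp [racgForm, simpleRoot, h, hne]

theorem racgForm_ne {u v : V} (hne : u ≠ v) :
    racgForm G (simpleRoot u) (simpleRoot v) ≤ 0 := by
  by_cases h : G.Adj u v
  · exact (racgForm_adj h).le
  · rw [racgForm_not_adj hne h]; norm_num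

variable (G) in
theorem rootSystem_simpleRoot : RootSystem G (racgForm G) rootHeight simpleRoot where
  self := racgForm_self
  adj _ _ := racgForm_adj
  not_adj _ _ hne h := (racgForm_not_adj hne h).le
  pos v := by rw [rootHeight_simpleRoot]; norm_num

variable (G) in
/-- The reflection in the simple root of a vertex. -/
noncomputable def simpleReflection (v : V) : (V → ℤ) ≃ₗ[ℤ] (V → ℤ) :=
  unitReflection (racgForm G) (simpleRoot v) (racgForm_self v)

theorem simpleReflection_apply (v : V) (a : V → ℤ) :
    simpleReflection G v a = a - (2 * racgForm G a (simpleRoot v)) • simpleRoot v :=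
  unitReflection_apply _ _ _ _

theorem simpleReflection_simpleReflection (v : V) (a : V → ℤ) :
    simpleReflection G v (simpleReflection G v a) = a :=
  LinearEquiv.congr_fun (unitReflection_mul_self (racgForm G) _ (racgForm_self v)) a

theorem racgForm_simpleReflection_left (v : V) (a b : V → ℤ) :
    racgForm G (simpleReflection G v a) b = racgForm G a (simpleReflection G v b) := by
  simp only [simpleReflection_apply, map_sub, LinearMap.sub_apply, map_smul, LinearMap.smul_apply,
    smul_eq_mul, racgForm_comm G b]
  ring

theorem racgForm_simpleReflection (v : V) (a b : V → ℤ) :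
    racgForm G (simpleReflection G v a) (simpleReflection G v b) = racgForm G a b := by
  rw [racgForm_simpleReflection_left, simpleReflection_simpleReflection]

theorem simpleReflection_adj {u v : V} (h : G.Adj u v) :
    simpleReflection G u (simpleRoot v) = simpleRoot v := by
  simp [simpleReflection_apply, racgForm_adj h.symm]

variable (G) in
/-- The real roots: the orbit of the simple roots. -/
inductive IsRealRoot : (V → ℤ) → Prop
  | simple (v : V) : IsRealRoot (simpleRoot v)
  | reflect (v : V) {a : V → ℤ} : IsRealRoot a → IsRealRoot (simpleReflection G v a)

theorem IsRealRoot.self {a : V → ℤ} (h : IsRealRoot G a) : racgForm G a a = 1 := by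
  induction h with
  | simple v => exact racgForm_self v
  | reflect v _ ih => rwa [racgForm_simpleReflection]

theorem IsRealRoot.mem_range {a : V → ℤ} (h : IsRealRoot G a) :
    unitReflection (racgForm G) a h.self ∈ (rootSystem_simpleRoot G).rep.range := by
  induction h with
  | simple v => exact ⟨racgGen G v, RootSystem.rep_gen _ v⟩
  | @reflect v a ha ih =>
    have hv : simpleReflection G v ∈ (rootSystem_simpleRoot G).rep.range :=
      ⟨racgGen G v, RootSystem.rep_gen _ v⟩
    convert mul_mem (mul_mem hv ih) hv using 1
    ext1 m
    simp only [LinearEquiv.mul_apply, unitReflection_apply, map_sub, map_smul,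
      simpleReflection_simpleReflection]
    rw [← racgForm_simpleReflection_left]

variable (G) in
/-- The positive roots that are reached from the edge between `x` and `z` on the side of `x`. The
walls of such roots are separated from the wall of `z` except possibly for that of `x` itself; the
natural number is the distance to the wall of `x` in the crossing graph of the walls. -/
inductive BranchRoot : V → V → ℕ → (V → ℤ) → Prop
  | base {x z : V} : G.Adj x z → BranchRoot x z 0 (simpleRoot x)
  | reflect {x z z' : V} {k : ℕ} {a : V → ℤ} : G.Adj x z → G.Adj x z' → z' ≠ z →
      BranchRoot x z' k a → BranchRoot x z k (simpleReflection G z' a)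
  | descend {x z x' : V} {k : ℕ} {a : V → ℤ} : G.Adj x z → G.Adj x x' → x' ≠ z →
      BranchRoot x' x k a → BranchRoot x z (k + 1) a

namespace BranchRoot

variable {x z : V} {k : ℕ} {a : V → ℤ}

theorem adj (h : BranchRoot G x z k a) : G.Adj x z := by
  cases h <;> assumption

theorem isRealRoot (h : BranchRoot G x z k a) : IsRealRoot G a := by
  induction h with
  | base _ => exact .simple _
  | reflect _ _ _ _ ih => exact .reflect _ ih
  | descend _ _ _ _ ih => exact ih

theorem eq_simpleRoot (h : BranchRoot G x z k a) (hk : k = 0) : a = simpleRoot x := by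
  induction h with
  | base _ => rfl
  | reflect _ hz' _ _ ih => rw [ih hk, simpleReflection_adj hz'.symm]
  | descend => omega

theorem racgForm_bounds (hG : G.IsAcyclic) (h : BranchRoot G x z k a) :
    (∀ y, G.Side x z y → racgForm G a (simpleRoot y) ≤ 0) ∧
    (∀ y, G.Side x z y → (1 ≤ k ∨ y ≠ z) → racgForm G a (simpleRoot y) ≤ -1) ∧
    (∀ y y', G.Side x z y → ¬ G.Side x z y' → (1 ≤ k ∨ y ≠ z ∨ y' ≠ x) →
      racgForm G a (simpleRoot y) + racgForm G a (simpleRoot y') ≤ 0) := by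
  have base : ∀ {x z : V}, G.Adj x z →
      (∀ y, G.Side x z y → racgForm G (simpleRoot x) (simpleRoot y) ≤ 0) ∧
      (∀ y, G.Side x z y → (1 ≤ 0 ∨ y ≠ z) → racgForm G (simpleRoot x) (simpleRoot y) ≤ -1) ∧
      (∀ y y', G.Side x z y → ¬ G.Side x z y' → (1 ≤ 0 ∨ y ≠ z ∨ y' ≠ x) →
        racgForm G (simpleRoot x) (simpleRoot y) +
          racgForm G (simpleRoot x) (simpleRoot y') ≤ 0) := by
    intro x z hxz
    have h2 : ∀ y, G.Side x z y → y ≠ z → racgForm G (simpleRoot x) (simpleRoot y) ≤ -1 :=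
      fun y hy hyz => (racgForm_not_adj hy.ne.symm fun hxy =>
        hyz (hG.eq_of_side_of_adj hy hxy)).le
    refine ⟨fun y hy => racgForm_ne hy.ne.symm, fun y hy hyz => h2 y hy (by simpa using hyz),
      fun y y' hy hy' hne => ?_⟩
    by_cases hyx : y' = x
    · have := h2 y hy (by simpa [hyx] using hne)
      rw [hyx, racgForm_self]
      linarith
    · exact add_nonpos (racgForm_ne hy.ne.symm) (racgForm_ne (Ne.symm hyx))
  induction h with
  | base hxz => exact base hxz
  | @descend x z x' k a hxz hxx' hne _ ih =>
    obtain ⟨ih1, ih2, ih3⟩ := ih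
    have hside : ∀ y, G.Side x z y → G.Side x' x y := fun y hy => hG.side_symm hy hxx' hne
    refine ⟨fun y hy => ih1 y (hside y hy), fun y hy _ => ih2 y (hside y hy) (.inr hy.ne),
      fun y y' hy hy' _ => ?_⟩
    by_cases hs : G.Side x' x y'
    · exact add_nonpos (ih1 y (hside y hy)) (ih1 y' hs)
    · exact ih3 y y' (hside y hy) hs (.inr (.inl hy.ne))
  | @reflect x z z' k a hxz hxz' hne hb ih =>
    obtain rfl | hk := Nat.eq_zero_or_pos k
    · rw [hb.eq_simpleRoot rfl, simpleReflection_adj hxz'.symm]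
      exact base hxz
    obtain ⟨ih1, ih2, ih3⟩ := ih
    have hz' := ih2 z' hxz'.side (.inl hk)
    have hval : ∀ y, racgForm G (simpleReflection G z' a) (simpleRoot y) =
        racgForm G a (simpleRoot y) -
          2 * racgForm G a (simpleRoot z') * racgForm G (simpleRoot z') (simpleRoot y) :=
      fun y => by
        simp only [simpleReflection_apply, map_sub, LinearMap.sub_apply, map_smul,
          LinearMap.smul_apply, smul_eq_mul]
    have hfar : ∀ y, G.Side x z y → racgForm G (simpleReflection G z' a) (simpleRoot y) =
        racgForm G a (simpleRoot y) + 2 * racgForm G a (simpleRoot z') ∧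
          racgForm G a (simpleRoot z') + racgForm G a (simpleRoot y) ≤ 0 := fun y hy => by
      refine ⟨?_, ih3 z' y hxz'.side (hG.not_side_of_ne hy hxz' hne) (.inl hk)⟩
      rw [hval, racgForm_not_adj (hG.ne_of_side hy hxz' hne).symm
        (hG.not_adj_of_side hy hxz' hne)]
      ring
    refine ⟨fun y hy => ?_, fun y hy _ => ?_, fun y y' hy hy' _ => ?_⟩
    · linarith [hfar y hy]
    · linarith [hfar y hy]
    · obtain ⟨h1, h2⟩ := hfar y hy
      rw [h1, hval y']
      by_cases hyz : y' = z'
      · rw [hyz, racgForm_self]; linarith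
      have h3 := racgForm_ne (G := G) (Ne.symm hyz)
      have h4 : 0 ≤ racgForm G a (simpleRoot z') *
        racgForm G (simpleRoot z') (simpleRoot y') := mul_nonneg_of_nonpos_of_nonpos (by linarith) h3
      by_cases hs : G.Side x z' y'
      · linarith [ih1 y' hs]
      · linarith [ih3 z' y' hxz'.side hs (.inl hk)]

theorem racgForm_le (hG : G.IsAcyclic) (h : BranchRoot G x z k a) (hk : 1 ≤ k) :
    racgForm G a (simpleRoot z) ≤ -1 :=
  (h.racgForm_bounds hG).2.1 z h.adj.side (.inl hk)

theorem height_pos (hG : G.IsAcyclic) (h : BranchRoot G x z k a) : 0 < rootHeight a := by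
  induction h with
  | base _ => rw [rootHeight_simpleRoot]; norm_num
  | reflect _ hz' _ hb ih =>
    have := (hb.racgForm_bounds hG).1 _ hz'.side
    rw [simpleReflection_apply, map_sub, map_smul, rootHeight_simpleRoot, smul_eq_mul]
    linarith
  | descend _ _ _ _ ih => exact ih

theorem racgForm_simpleRoot_eq_zero (h : BranchRoot G x z k a) (hk : k = 1) :
    racgForm G a (simpleRoot x) = 0 := by
  induction h with
  | base => omega
  | reflect _ hz' _ _ ih =>
    rw [racgForm_simpleReflection_left, simpleReflection_adj hz'.symm]
    exact ih hk
  | descend _ hx' _ hb _ =>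
    rw [hb.eq_simpleRoot (by omega)]
    exact racgForm_adj hx'.symm

theorem racgForm_simpleRoot_le (hG : G.IsAcyclic) (h : BranchRoot G x z k a) (hk : 2 ≤ k) :
    racgForm G a (simpleRoot x) ≤ -1 := by
  induction h with
  | base => omega
  | reflect _ hz' _ _ ih =>
    rw [racgForm_simpleReflection_left, simpleReflection_adj hz'.symm]
    exact ih hk
  | descend _ _ _ hb _ => exact hb.racgForm_le hG (by omega)

end BranchRoot

variable (G) in
/-- The positive roots that lie behind the edge labelled `z` of the wall of `x`. -/
def CrossRoot (x z : V) (k : ℕ) (a : V → ℤ) : Prop :=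
  (∃ j, k = j + 1 ∧ BranchRoot G z x j a) ∨
    (G.Adj x z ∧ ∃ b, a = simpleReflection G z b ∧ BranchRoot G x z k b)

variable {x z z' : V} {j k : ℕ} {a b : V → ℤ}

theorem BranchRoot.crossRoot (h : BranchRoot G z x k a) : CrossRoot G x z (k + 1) a :=
  .inl ⟨k, rfl, h⟩

theorem BranchRoot.crossRoot_reflect (h : BranchRoot G x z k a) :
    CrossRoot G x z k (simpleReflection G z a) :=
  .inr ⟨h.adj, a, rfl, h⟩

theorem CrossRoot.branchRoot (h : CrossRoot G x z k a) (hz : G.Adj x z') (hne : z' ≠ z) :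
    BranchRoot G x z' k a := by
  obtain ⟨j, rfl, hj⟩ | ⟨hadj, b, rfl, hb⟩ := h
  · exact .descend hz hj.adj.symm hne.symm hj
  · exact .reflect hz hadj hne.symm hb

theorem BranchRoot.racgForm_crossRoot_le (hG : G.IsAcyclic) (h : BranchRoot G x z j a)
    (hb : CrossRoot G x z k b) (hk : 1 ≤ k) (hjk : 2 ≤ j + k) : racgForm G a b ≤ -1 := by
  induction h generalizing k b with
  | base hxz =>
    rw [racgForm_comm]
    obtain ⟨i, rfl, hi⟩ | ⟨hadj, b, rfl, hb⟩ := hb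
    · exact hi.racgForm_le hG (by omega)
    · rw [racgForm_simpleReflection_left, simpleReflection_adj hxz.symm]
      exact hb.racgForm_simpleRoot_le hG (by omega)
  | reflect hxz hxz' hne _ ih =>
    rw [racgForm_simpleReflection_left]
    exact ih (hb.branchRoot hxz' hne).crossRoot_reflect hk hjk
  | descend hxz hxz' hne _ ih =>
    exact ih (hb.branchRoot hxz' hne).crossRoot (by omega) (by omega)

theorem CrossRoot.racgForm_le (hG : G.IsAcyclic) (ha : CrossRoot G x z j a)
    (hb : CrossRoot G x z' k b) (hne : z ≠ z') (hz' : G.Adj x z') (hj : 1 ≤ j) (hk : 1 ≤ k) :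
    racgForm G a b ≤ -1 :=
  (ha.branchRoot hz' hne.symm).racgForm_crossRoot_le hG hb hk (by omega)

theorem BranchRoot.crossRoot_reflect_reflect {b c : V} (h : BranchRoot G x c k a)
    (hb : G.Adj x b) (hbc : b ≠ c) :
    CrossRoot G x b k (simpleReflection G b (simpleReflection G c a)) :=
  BranchRoot.crossRoot_reflect (.reflect hb h.adj hbc.symm h)

theorem racgForm_iterate {f : (V → ℤ) → (V → ℤ)}
    (hf : ∀ a b, racgForm G (f a) (f b) = racgForm G a b) (n : ℕ) (a b : V → ℤ) :
    racgForm G (f^[n] a) (f^[n] b) = racgForm G a b := by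
  induction n with
  | zero => rfl
  | succ n ih => rw [Function.iterate_succ_apply', Function.iterate_succ_apply', hf, ih]

/-- Branches whose roots have neighbours of `x` as labels can be put behind the edges of the wall
of `x` in such a way that distinct branches are disjoint, provided that the wall has enough
edges. -/
theorem exists_branch_placement {N : Type*} [Countable N] (hG : G.IsAcyclic) (hxz : G.Adj x z)
    (T : Set N) (c : N → V) (hc : ∀ i ∈ T, G.Adj x (c i))
    (h2 : T.Nonempty → ∃ b, G.Adj x b ∧ b ≠ z)
    (h3 : T.Nontrivial → ∃ b b', G.Adj x b ∧ G.Adj x b' ∧ b ≠ z ∧ b' ≠ z ∧ b ≠ b') :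
    ∃ g : N → (V → ℤ) → (V → ℤ),
      (∀ i a b, racgForm G (g i a) (g i b) = racgForm G a b) ∧
      (∀ i ∈ T, ∀ k a, BranchRoot G (c i) x k a → BranchRoot G x z (k + 1) (g i a)) ∧
      (∀ i ∈ T, ∀ j ∈ T, i ≠ j → ∀ k l a b, BranchRoot G (c i) x k a → BranchRoot G (c j) x l b →
        racgForm G (g i a) (g j b) ≤ -1) := by
  classical
  by_cases hT : T.Nontrivial
  · obtain ⟨f, hf⟩ := Countable.exists_injective_nat N
    obtain ⟨b, b', hb, hb', hbz, hbz', hbb⟩ := h3 hT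
    set t : (V → ℤ) → (V → ℤ) := fun a => simpleReflection G b (simpleReflection G b' a) with ht
    have htf : ∀ a a', racgForm G (t a) (t a') = racgForm G a a' := fun a a' => by
      simp only [ht, racgForm_simpleReflection]
    set e : N → (V → ℤ) → (V → ℤ) := fun i a =>
      simpleReflection G z (if c i = z then simpleReflection G b a else a) with he
    have hef : ∀ i a a', racgForm G (e i a) (e i a') = racgForm G a a' := fun i a a' => by
      by_cases hi : c i = z <;> simp only [he, hi, if_true, if_false, racgForm_simpleReflection]
    have hez : ∀ i ∈ T, ∀ k a, BranchRoot G (c i) x k a → CrossRoot G x z (k + 1) (e i a) := by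
      intro i hi k a ha
      refine BranchRoot.crossRoot_reflect ?_
      by_cases hiz : c i = z
      · rw [if_pos hiz]
        exact .reflect hxz hb hbz (.descend hb (hc i hi) (by rw [hiz]; exact hbz.symm) ha)
      · rw [if_neg hiz]
        exact .descend hxz (hc i hi) hiz ha
    have hit : ∀ n k a, CrossRoot G x z k a → CrossRoot G x b k (t^[n + 1] a) := by
      intro n k a ha
      induction n with
      | zero => exact (ha.branchRoot hb' hbz').crossRoot_reflect_reflect hb hbb
      | succ n ih =>
        rw [Function.iterate_succ_apply']
        exact (ih.branchRoot hb' hbb.symm).crossRoot_reflect_reflect hb hbb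
    have hlt : ∀ i ∈ T, ∀ j ∈ T, f i < f j → ∀ k l a a', BranchRoot G (c i) x k a →
        BranchRoot G (c j) x l a' →
        racgForm G (t^[f i + 1] (e i a)) (t^[f j + 1] (e j a')) ≤ -1 := by
      intro i hi j hj hij k l a a' ha ha'
      obtain ⟨m, hm⟩ := Nat.exists_eq_add_of_lt hij
      rw [show f j + 1 = (f i + 1) + (m + 1) by omega,
        Function.iterate_add_apply t (f i + 1) (m + 1),
        racgForm_iterate htf]
      exact (hez i hi k a ha).racgForm_le hG (hit m _ _ (hez j hj l a' ha')) hbz.symm hb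
        (by omega) (by omega)
    refine ⟨fun i a => t^[f i + 1] (e i a), fun i a a' => ?_, fun i hi k a ha => ?_,
      fun i hi j hj hij k l a a' ha ha' => ?_⟩
    · rw [racgForm_iterate htf, hef]
    · exact (hit (f i) _ _ (hez i hi k a ha)).branchRoot hxz hbz.symm
    · rcases lt_or_gt_of_ne (hf.ne hij) with h | h
      · exact hlt i hi j hj h k l a a' ha ha'
      · rw [racgForm_comm]
        exact hlt j hj i hi h l k a' a ha' ha
  · rw [Set.not_nontrivial_iff] at hT
    by_cases hne : T.Nonempty
    · obtain ⟨b, hb, hbz⟩ := h2 hne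
      refine ⟨fun i a => if c i = z then simpleReflection G b a else a, fun i a a' => ?_,
        fun i hi k a ha => ?_, fun i hi j hj hij => absurd (hT hi hj) hij⟩
      · by_cases hi : c i = z <;> simp only [hi, if_true, if_false, racgForm_simpleReflection]
      · by_cases hiz : c i = z
        · simp only [if_pos hiz]
          exact .reflect hxz hb hbz (.descend hb (hc i hi) (by rw [hiz]; exact hbz.symm) ha)
        · simp only [if_neg hiz]
          exact .descend hxz (hc i hi) hiz ha
    · exact ⟨fun _ a => a, fun _ _ _ => rfl, fun i hi => absurd ⟨i, hi⟩ hne,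
        fun i hi => absurd ⟨i, hi⟩ hne⟩

end Form

section Branch

variable {VR VS : Type*} [Fintype VS] {R : SimpleGraph VR} {S : SimpleGraph VS}

/-- Vectors for the vertices on the side of `v` of the edge from `p` to `v` that pair like simple
roots, and that are roots on the side of `φ v` of the edge between `φ v` and `φ p`. -/
structure BranchFamily (φ : R →g S) (p v : VR) (a : VR → VS → ℤ) : Prop where
  branchRoot : ∀ w, R.Side p v w → ∃ k, BranchRoot S (φ v) (φ p) k (a w) ∧
    (w = v ∧ k = 0 ∨ R.Adj v w ∧ k = 1 ∨ w ≠ v ∧ ¬ R.Adj v w ∧ 2 ≤ k)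
  adj : ∀ u w, R.Side p v u → R.Side p v w → R.Adj u w → racgForm S (a u) (a w) = 0
  not_adj : ∀ u w, R.Side p v u → R.Side p v w → u ≠ w → ¬ R.Adj u w →
    racgForm S (a u) (a w) ≤ -1

theorem exists_branchFamily [Finite VR] (hR : R.IsAcyclic) (hS : S.IsAcyclic) (φ : R →g S)
    (h2 : ∀ v : VR, (R.neighborSet v).ncard = 2 → 2 ≤ (S.neighborSet (φ v)).ncard)
    (h3 : ∀ v : VR, 3 ≤ (R.neighborSet v).ncard → 3 ≤ (S.neighborSet (φ v)).ncard)
    (p v : VR) (hpv : R.Adj p v) : ∃ a, BranchFamily φ p v a := by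
  classical
  induction hn : {w | R.Side p v w}.ncard using Nat.strong_induction_on generalizing p v with
  | _ n ih =>
  subst hn
  have hfam : ∀ u, ∃ a, R.Adj v u → u ≠ p → BranchFamily φ v u a := fun u => by
    by_cases hu : R.Adj v u ∧ u ≠ p
    · obtain ⟨a, ha⟩ := ih _ (Set.ncard_lt_ncard (s := {w | R.Side v u w})
        (t := {w | R.Side p v w}) ⟨fun w hw => hR.side_symm hw hpv.symm hu.2.symm,
          fun hle => (hle (a := v) hpv.side : R.Side v u v).ne rfl⟩ (Set.toFinite _)) v u hu.1 rfl
      exact ⟨a, fun _ _ => ha⟩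
    · exact ⟨0, fun h h' => absurd ⟨h, h'⟩ hu⟩
  choose fam hfam using hfam
  have hchild : ∀ w, ∃ u, R.Side p v w → w ≠ v → u ≠ p ∧ R.Side v u w := fun w => by
    by_cases hw : R.Side p v w ∧ w ≠ v
    · obtain ⟨u, hu⟩ := hw.1.eq_or_exists.resolve_left hw.2
      exact ⟨u, fun _ _ => hu⟩
    · exact ⟨v, fun h h' => absurd ⟨h, h'⟩ hw⟩
  choose ch hch using hchild
  have hpS : p ∈ R.neighborSet v := hpv.symm
  have hzS : φ p ∈ S.neighborSet (φ v) := φ.map_adj hpv.symm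
  have hcard : ∀ m, m + 1 ≤ (S.neighborSet (φ v)).ncard →
      m ≤ (S.neighborSet (φ v) \ {φ p}).ncard := fun m hm => by
    have := Set.ncard_sdiff_singleton_add_one hzS (Set.toFinite _)
    omega
  have hcardR := Set.ncard_sdiff_singleton_add_one hpS (Set.toFinite _)
  have hplace3 : (R.neighborSet v \ {p}).Nontrivial → 2 ≤ (S.neighborSet (φ v) \ {φ p}).ncard :=
    fun hT => by
      have h1 := Set.one_lt_ncard_iff_nontrivial.2 hT
      exact hcard 2 (h3 v (by omega))
  obtain ⟨g, hgf, hgb, hgc⟩ := exists_branch_placement hS (φ.map_adj hpv.symm)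
    (R.neighborSet v \ {p}) φ (fun i hi => φ.map_adj hi.1)
    (fun hT => by
      have h1 : 1 ≤ (S.neighborSet (φ v) \ {φ p}).ncard := by
        by_cases hT' : (R.neighborSet v \ {p}).Nontrivial
        · exact le_trans (by norm_num) (hplace3 hT')
        · have h1 := (Set.ncard_pos (Set.toFinite _)).2 hT
          have h2' := mt Set.one_lt_ncard_iff_nontrivial.1 hT'
          exact hcard 1 (h2 v (by omega))
      obtain ⟨b, hb⟩ := (Set.ncard_pos (Set.toFinite _)).1 h1
      exact ⟨b, hb.1, hb.2⟩)
    (fun hT => by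
      obtain ⟨b, hb, b', hb', hne⟩ :=
        Set.one_lt_ncard_iff_nontrivial.1 (hplace3 hT)
      exact ⟨b, b', hb.1, hb'.1, hb.2, hb'.2, hne⟩)
  set a : VR → VS → ℤ := fun w => if w = v then simpleRoot (φ v) else g (ch w) (fam (ch w) w)
    with ha
  have hav : a v = simpleRoot (φ v) := if_pos rfl
  have haw : ∀ w, w ≠ v → a w = g (ch w) (fam (ch w) w) := fun w hw => if_neg hw
  have hside : ∀ w, R.Side p v w → w ≠ v → ch w ∈ R.neighborSet v \ {p} ∧ R.Side v (ch w) w ∧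
      BranchFamily φ v (ch w) (fam (ch w)) := fun w hw hwv => by
    obtain ⟨h1, h2⟩ := hch w hw hwv
    exact ⟨⟨h2.adj, h1⟩, h2, hfam _ h2.adj h1⟩
  have hroot : ∀ w, R.Side p v w → ∃ k, BranchRoot S (φ v) (φ p) k (a w) ∧
      (w = v ∧ k = 0 ∨ R.Adj v w ∧ k = 1 ∨ w ≠ v ∧ ¬ R.Adj v w ∧ 2 ≤ k) := fun w hw => by
    by_cases hwv : w = v
    · subst hwv
      rw [hav]
      exact ⟨0, .base (φ.map_adj hpv.symm), .inl ⟨rfl, rfl⟩⟩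
    obtain ⟨hmem, hs, hf⟩ := hside w hw hwv
    obtain ⟨k, hk, hcase⟩ := hf.branchRoot w hs
    refine ⟨k + 1, by rw [haw w hwv]; exact hgb _ hmem k _ hk, .inr ?_⟩
    by_cases hadj : R.Adj v w
    · have := hR.eq_of_side_of_adj hs hadj
      obtain ⟨-, h⟩ | ⟨h, -⟩ | ⟨h, -⟩ := hcase
      · exact .inl ⟨hadj, by omega⟩
      · exact absurd this h.ne'
      · exact absurd this h
    · refine .inr ⟨hwv, hadj, ?_⟩
      obtain ⟨h, -⟩ | ⟨-, h⟩ | ⟨-, -, h⟩ := hcase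
      · exact absurd (h ▸ hs.adj) hadj
      · omega
      · omega
  have hself : ∀ w, R.Side p v w → w ≠ v → (R.Adj v w → racgForm S (a w) (a v) = 0) ∧
      (¬ R.Adj v w → racgForm S (a w) (a v) ≤ -1) := fun w hw hwv => by
    obtain ⟨k, hk, hcase⟩ := hroot w hw
    rw [hav]
    obtain ⟨h, -⟩ | ⟨h, h'⟩ | ⟨-, h, h'⟩ := hcase
    · exact absurd h hwv
    · exact ⟨fun _ => hk.racgForm_simpleRoot_eq_zero h', fun h'' => absurd h h''⟩
    · exact ⟨fun h'' => absurd h'' h, fun _ => hk.racgForm_simpleRoot_le hS h'⟩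
  have hcross : ∀ u w, R.Side p v u → R.Side p v w → u ≠ v → w ≠ v → ch u ≠ ch w →
      ¬ R.Adj u w ∧ racgForm S (a u) (a w) ≤ -1 := fun u w hu hw huv hwv hne => by
    obtain ⟨hmu, hsu, hfu⟩ := hside u hu huv
    obtain ⟨hmw, hsw, hfw⟩ := hside w hw hwv
    refine ⟨fun hadj => hR.not_side_of_ne hsw hmu.1 hne (hsu.step hadj hwv), ?_⟩
    obtain ⟨k, hk, -⟩ := hfu.branchRoot u hsu
    obtain ⟨l, hl, -⟩ := hfw.branchRoot w hsw
    rw [haw u huv, haw w hwv]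
    exact hgc _ hmu _ hmw hne k l _ _ hk hl
  refine ⟨a, hroot, fun u w hu hw hadj => ?_, fun u w hu hw hne hadj => ?_⟩
  · by_cases huv : u = v
    · subst huv
      rw [racgForm_comm]
      exact (hself w hw hadj.ne').1 hadj
    by_cases hwv : w = v
    · subst hwv
      exact (hself u hu huv).1 hadj.symm
    by_cases hc : ch u = ch w
    · obtain ⟨-, hsu, hf⟩ := hside u hu huv
      rw [haw u huv, haw w hwv, ← hc, hgf]
      exact hf.adj u w hsu (hc ▸ (hside w hw hwv).2.1) hadj
    · exact absurd hadj (hcross u w hu hw huv hwv hc).1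
  · by_cases huv : u = v
    · subst huv
      rw [racgForm_comm]
      exact (hself w hw hne.symm).2 hadj
    by_cases hwv : w = v
    · subst hwv
      exact (hself u hu huv).2 fun h => hadj h.symm
    by_cases hc : ch u = ch w
    · obtain ⟨-, hsu, hf⟩ := hside u hu huv
      rw [haw u huv, haw w hwv, ← hc, hgf]
      exact hf.not_adj u w hsu (hc ▸ (hside w hw hwv).2.1) hne hadj
    · exact (hcross u w hu hw huv hwv hc).2

theorem BranchFamily.racgForm_opposite (hR : R.IsAcyclic) (hS : S.IsAcyclic) {φ : R →g S}
    {p v : VR} {a b : VR → VS → ℤ} (ha : BranchFamily φ p v a) (hb : BranchFamily φ v p b)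
    {u w : VR} (hu : R.Side p v u) (hw : R.Side v p w) :
    (R.Adj u w → racgForm S (a u) (b w) = 0) ∧ (¬ R.Adj u w → racgForm S (a u) (b w) ≤ -1) := by
  have hpv := hu.adj
  obtain ⟨j, hj, hju⟩ := ha.branchRoot u hu
  obtain ⟨k, hk, hkw⟩ := hb.branchRoot w hw
  have hzero : u = v ∧ w = p → racgForm S (a u) (b w) = 0 := by
    rintro ⟨rfl, rfl⟩
    rw [hj.eq_simpleRoot (by simpa using hju), hk.eq_simpleRoot (by simpa using hkw)]
    exact racgForm_adj (φ.map_adj hpv.symm)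
  refine ⟨fun hadj => hzero ?_, fun hadj => ?_⟩
  · have hwp : w = p := by
      by_contra hwp
      exact hR.not_side_of_side hw (hu.step hadj hwp)
    subst hwp
    exact ⟨hR.eq_of_side_of_adj hu hadj.symm, rfl⟩
  · obtain rfl | hk0 := Nat.eq_zero_or_pos k
    · have hwp : w = p := by
        rcases hkw with ⟨h, -⟩ | ⟨-, h⟩ | ⟨-, -, h⟩
        · exact h
        · omega
        · omega
      subst hwp
      have hj0 : 1 ≤ j := by
        rcases hju with ⟨h, -⟩ | ⟨-, h⟩ | ⟨-, -, h⟩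
        · exact absurd (h ▸ hpv.symm) hadj
        · omega
        · omega
      rw [racgForm_comm]
      exact hk.racgForm_crossRoot_le hS hj.crossRoot (by omega) (by omega)
    · exact hj.racgForm_crossRoot_le hS hk.crossRoot (by omega) (by omega)

theorem exists_rootSystem_of_hom [Finite VR] (hR : R.IsTree) (hS : S.IsAcyclic) (φ : R →g S)
    (h2 : ∀ v : VR, (R.neighborSet v).ncard = 2 → 2 ≤ (S.neighborSet (φ v)).ncard)
    (h3 : ∀ v : VR, 3 ≤ (R.neighborSet v).ncard → 3 ≤ (S.neighborSet (φ v)).ncard) :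
    ∃ a : VR → VS → ℤ, RootSystem R (racgForm S) rootHeight a ∧ ∀ v, IsRealRoot S (a v) := by
  classical
  by_cases hedge : ∃ p v, R.Adj p v
  · obtain ⟨p, v, hpv⟩ := hedge
    obtain ⟨a, ha⟩ := exists_branchFamily hR.2 hS φ h2 h3 p v hpv
    obtain ⟨b, hb⟩ := exists_branchFamily hR.2 hS φ h2 h3 v p hpv.symm
    set c : VR → VS → ℤ := fun w => if R.Side p v w then a w else b w with hc
    have hca : ∀ w, R.Side p v w → c w = a w := fun w hw => if_pos hw
    have hcb : ∀ w, ¬ R.Side p v w → c w = b w ∧ R.Side v p w := fun w hw =>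
      ⟨if_neg hw, (hR.side_or_side hpv w).resolve_left hw⟩
    have hroot : ∀ w, ∃ x z k, BranchRoot S x z k (c w) := fun w => by
      by_cases hw : R.Side p v w
      · rw [hca w hw]
        obtain ⟨k, hk, -⟩ := ha.branchRoot w hw
        exact ⟨_, _, k, hk⟩
      · rw [(hcb w hw).1]
        obtain ⟨k, hk, -⟩ := hb.branchRoot w (hcb w hw).2
        exact ⟨_, _, k, hk⟩
    have hreal : ∀ w, IsRealRoot S (c w) := fun w => by
      obtain ⟨x, z, k, hk⟩ := hroot w
      exact hk.isRealRoot
    have hpair : ∀ u w, (R.Adj u w → racgForm S (c u) (c w) = 0) ∧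
        (u ≠ w → ¬ R.Adj u w → racgForm S (c u) (c w) ≤ -1) := fun u w => by
      by_cases hu : R.Side p v u <;> by_cases hw : R.Side p v w
      · rw [hca u hu, hca w hw]
        exact ⟨ha.adj u w hu hw, ha.not_adj u w hu hw⟩
      · obtain ⟨hcw, hw'⟩ := hcb w hw
        rw [hca u hu, hcw]
        have h := ha.racgForm_opposite hR.2 hS hb hu hw'
        exact ⟨h.1, fun _ => h.2⟩
      · obtain ⟨hcu, hu'⟩ := hcb u hu
        rw [hcu, hca w hw]
        have h := hb.racgForm_opposite hR.2 hS ha hu' hw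
        exact ⟨h.1, fun _ => h.2⟩
      · obtain ⟨hcu, hu'⟩ := hcb u hu
        obtain ⟨hcw, hw'⟩ := hcb w hw
        rw [hcu, hcw]
        exact ⟨hb.adj u w hu' hw', hb.not_adj u w hu' hw'⟩
    refine ⟨c, ⟨fun w => (hreal w).self, fun u w => (hpair u w).1, fun u w => (hpair u w).2,
      fun w => ?_⟩, hreal⟩
    obtain ⟨x, z, k, hk⟩ := hroot w
    exact hk.height_pos hS
  · have hsub : ∀ u w : VR, u = w := fun u w => by
      obtain ⟨q⟩ := hR.1.preconnected u w
      cases q with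
      | nil => rfl
      | cons h _ => exact absurd ⟨_, _, h⟩ hedge
    refine ⟨fun w => simpleRoot (φ w), ⟨fun w => racgForm_self _,
      fun u w h => absurd ⟨_, _, h⟩ hedge, fun u w hne => absurd (hsub u w) hne,
      fun w => ?_⟩, fun w => .simple _⟩
    rw [rootHeight_simpleRoot]; norm_num

end Branch

theorem racg_tree_embeds_of_hom {VR VS : Type*} [Fintype VR] [Fintype VS]
    (R : SimpleGraph VR) (S : SimpleGraph VS) (hR : R.IsTree) (hS : S.IsTree)
    (φ : SimpleGraph.Hom R S)
    (h2 : ∀ v : VR, (R.neighborSet v).ncard = 2 → 2 ≤ (S.neighborSet (φ v)).ncard)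
    (h3 : ∀ v : VR, 3 ≤ (R.neighborSet v).ncard → 3 ≤ (S.neighborSet (φ v)).ncard) :
    ∃ ψ : RACG R →* RACG S, Function.Injective ψ := by
  obtain ⟨a, ha, hreal⟩ := exists_rootSystem_of_hom hR hS.2 φ h2 h3
  exact (rootSystem_simpleRoot S).exists_injective_hom ha fun v => (hreal v).mem_range
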